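/- arXiv:1802.01355 — 2 statements merged into one kernel-verified Lean document; each statement's English description precedes it below -/
import Mathlib

section
/- Limit normal form theorem: A partial function G :⊆ ℕ^ℕ → ℕ^ℕ on Baire space is limit computable if and only if there exists a computable partial function F :⊆ ℕ^ℕ → ℕ^ℕ such that G = lim ∘ F. -/
open scoped Classical

namespace LimitComp

/-- Baire space `ℕ^ℕ`. -/
abbrev Baire : Type := ℕ → ℕ

/-- The finite prefix of length `k` of a point of Baire space. -/
def pre (p : Baire) (k : ℕ) : List ℕ := List.ofFn fun i : Fin k => p i

/-- Interleaving pairing `⟨q,p⟩(2n) = q(n)`, `⟨q,p⟩(2n+1) = p(n)`. -/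
def pairB (q p : Baire) : Baire := fun n => if n % 2 = 0 then q (n / 2) else p (n / 2)

/-- The `i`-th component of a tupling `⟨p₀,p₁,p₂,...⟩`. -/
def seqOf (p : Baire) (i : ℕ) : Baire := fun n => p (Nat.pair i n)

/-- Tupling `⟨p₀,p₁,p₂,...⟩` of a sequence of points of Baire space. -/
def tup (ps : ℕ → Baire) : Baire := fun m => ps m.unpair.1 m.unpair.2

/-- The limit map `lim :⊆ ℕ^ℕ → ℕ^ℕ`; it maps `⟨p₀,p₁,p₂,...⟩` to its pointwise
limit, which is defined whenever every coordinate is eventually constant. -/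
noncomputable def limB : Baire →. Baire := fun p =>
  ⟨∀ n, ∃ i₀, ∀ i, i₀ ≤ i → seqOf p i n = seqOf p i₀ n,
   fun h n => seqOf p (Classical.choose (h n)) n⟩

/-- Monotonicity of a finite approximation function under prefix extension
(this corresponds to a one-way output tape). -/
def PrefixMono (η : List ℕ → ℕ → Option ℕ) : Prop :=
  ∀ u v n y, u <+: v → η u n = some y → η v n = some y

/-- `η` approximates the partial function `F`: for every input in the domain of `F`
every output position is eventually filled with the correct output value. -/
def OneWayApprox (η : List ℕ → ℕ → Option ℕ) (F : Baire →. Baire) : Prop :=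
  ∀ p q, q ∈ F p → ∀ n, ∃ k, η (pre p k) n = some (q n)

/-- Computability for partial functions on Baire space: `F` is computed by a
Turing machine with one-way output tape, formalized via a computable monotone
finite approximation function. -/
def ComputableFn (F : Baire →. Baire) : Prop :=
  ∃ η : List ℕ → ℕ → Option ℕ, Computable₂ η ∧ PrefixMono η ∧ OneWayApprox η F

/-- `η` is a limit approximation of `F`: on every input in the domain of `F`,
every output cell eventually stabilizes to the correct output value. -/
def LimitApprox (η : List ℕ → ℕ → ℕ) (F : Baire →. Baire) : Prop :=
  ∀ p q, q ∈ F p → ∀ n, ∃ k₀, ∀ k, k₀ ≤ k → η (pre p k) n = q n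

/-- Limit computability for partial functions on Baire space: `F` is computed by
a Turing machine with a two-way output tape such that on inputs in the domain
every output cell eventually stabilizes. -/
def LimitComputableFn (F : Baire →. Baire) : Prop :=
  ∃ η : List ℕ → ℕ → ℕ, Computable₂ η ∧ LimitApprox η F

/-- The `i`-th Turing machine halts on input `p ∈ ℕ^ℕ` (i.e. it halts after
having read some finite prefix of `p`). -/
def haltsOn (i : ℕ) (p : Baire) : Prop :=
  ∃ k, ((Denumerable.ofNat Nat.Partrec.Code i).eval (Encodable.encode (pre p k))).Dom

/-- The Turing jump operator `J : ℕ^ℕ → ℕ^ℕ`. -/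
noncomputable def jump (p : Baire) : Baire := fun i => if haltsOn i p then 1 else 0

/-- The halting problem `0'`. -/
noncomputable def zero' : Baire := jump fun _ => 0

/-- `F` is computable relative to the oracle `q`. -/
def ComputableRel (q : Baire) (F : Baire →. Baire) : Prop :=
  ∃ G : Baire →. Baire, ComputableFn G ∧ ∀ p r, r ∈ F p → r ∈ G (pairB q p)

/-- `F` is limit computable relative to the oracle `q`. -/
def LimitComputableRel (q : Baire) (F : Baire →. Baire) : Prop :=
  ∃ G : Baire →. Baire, LimitComputableFn G ∧ ∀ p r, r ∈ F p → r ∈ G (pairB q p)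

/-- Turing reducibility for points of Baire space. -/
def TuringLe (p q : Baire) : Prop :=
  ∃ F : Baire →. Baire, ComputableFn F ∧ p ∈ F q

end LimitComp

namespace LimitComp

@[simp]
theorem length_pre (p : Baire) (k : ℕ) : (pre p k).length = k := by
  simp [pre]

theorem take_pre (p : Baire) {i k : ℕ} (h : i ≤ k) : (pre p k).take i = pre p i := by
  apply List.ext_getElem
  · simpa using h
  · intro j h₁ h₂
    simp [pre]

theorem pre_prefix (p : Baire) {i k : ℕ} (h : i ≤ k) : pre p i <+: pre p k :=
  take_pre p h ▸ List.take_prefix i (pre p k)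

theorem mem_limB_iff {p q : Baire} :
    q ∈ limB p ↔ ∀ n, ∃ i₀, ∀ i, i₀ ≤ i → seqOf p i n = q n := by
  constructor
  · rintro ⟨h, rfl⟩ n
    exact ⟨_, Classical.choose_spec (h n)⟩
  · intro h
    have hd : (limB p).Dom := fun n => by
      obtain ⟨i₀, hi⟩ := h n
      exact ⟨i₀, fun i hle => (hi i hle).trans (hi i₀ le_rfl).symm⟩
    refine ⟨hd, funext fun n => ?_⟩
    obtain ⟨i₀, hi⟩ := h n
    exact (Classical.choose_spec (hd n) _ (le_max_left _ i₀)).symm.trans (hi _ (le_max_right _ _))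

theorem mem_comp_iff {F H : Baire →. Baire} {p q : Baire} :
    q ∈ H.comp F p ↔ ∃ r, r ∈ F p ∧ q ∈ H r :=
  Part.mem_bind_iff

/-- One-way approximation of the function mapping `p` to the sequence of the outputs of `η` on
the prefixes of `p`: the `i`-th component is written once `i` input symbols have been read. -/
def stagesApprox (η : List ℕ → ℕ → ℕ) (u : List ℕ) (m : ℕ) : Option ℕ :=
  bif decide (m.unpair.1 ≤ u.length) then some (η (u.take m.unpair.1) m.unpair.2) else none

theorem stagesApprox_of_le {η : List ℕ → ℕ → ℕ} {u : List ℕ} {m : ℕ}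
    (h : m.unpair.1 ≤ u.length) :
    stagesApprox η u m = some (η (u.take m.unpair.1) m.unpair.2) := by
  simp [stagesApprox, h]

theorem computable₂_stagesApprox {η : List ℕ → ℕ → ℕ} (hη : Computable₂ η) :
    Computable₂ (stagesApprox η) := by
  have hstage : Primrec fun a : List ℕ × ℕ => a.2.unpair.1 :=
    Primrec.fst.comp (Primrec.unpair.comp Primrec.snd)
  have hcell : Primrec fun a : List ℕ × ℕ => a.2.unpair.2 :=
    Primrec.snd.comp (Primrec.unpair.comp Primrec.snd)
  have hle : Primrec fun a : List ℕ × ℕ => decide (a.2.unpair.1 ≤ a.1.length) :=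
    (Primrec.nat_le.comp hstage (Primrec.list_length.comp Primrec.fst)).decide
  have htake : Primrec fun a : List ℕ × ℕ => a.1.take a.2.unpair.1 :=
    Primrec.list_take.comp hstage Primrec.fst
  exact Computable.cond hle.to_comp
    (Computable.option_some.comp (hη.comp htake.to_comp hcell.to_comp)) (Computable.const none)

theorem prefixMono_stagesApprox (η : List ℕ → ℕ → ℕ) : PrefixMono (stagesApprox η) := by
  intro u v m y huv hy
  by_cases h : m.unpair.1 ≤ u.length
  · rw [stagesApprox_of_le h] at hy
    rw [stagesApprox_of_le (h.trans huv.length_le), ← hy]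
    obtain ⟨w, rfl⟩ := huv
    rw [List.take_append_of_le_length h]
  · simp [stagesApprox, h] at hy

/-- The function mapping `p ∈ dom(G)` to the sequence of stages of the approximation `η`. -/
def stages (η : List ℕ → ℕ → ℕ) (G : Baire →. Baire) : Baire →. Baire :=
  fun p => (G p).map fun _ => tup fun i => η (pre p i)

theorem mem_stages_iff {η : List ℕ → ℕ → ℕ} {G : Baire →. Baire} {p r : Baire} :
    r ∈ stages η G p ↔ ∃ q, q ∈ G p ∧ (tup fun i => η (pre p i)) = r :=
  Part.mem_map_iff _

theorem computableFn_stages {η : List ℕ → ℕ → ℕ} (hη : Computable₂ η) (G : Baire →. Baire) :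
    ComputableFn (stages η G) := by
  refine ⟨stagesApprox η, computable₂_stagesApprox hη, prefixMono_stagesApprox η, ?_⟩
  intro p q hq m
  obtain ⟨r, -, rfl⟩ := mem_stages_iff.1 hq
  refine ⟨m.unpair.1, ?_⟩
  rw [stagesApprox_of_le (by simp), take_pre p le_rfl]
  rfl

theorem mem_limB_tup {η : List ℕ → ℕ → ℕ} {G : Baire →. Baire} (hG : LimitApprox η G)
    {p q : Baire} (hq : q ∈ G p) : q ∈ limB (tup fun i => η (pre p i)) := by
  rw [mem_limB_iff]
  intro n
  simpa [seqOf, tup] using hG p q hq n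

theorem eq_limB_comp_stages {η : List ℕ → ℕ → ℕ} {G : Baire →. Baire} (hG : LimitApprox η G) :
    G = limB.comp (stages η G) := by
  funext p
  ext q
  simp only [mem_comp_iff, mem_stages_iff]
  constructor
  · intro hq
    exact ⟨_, ⟨q, hq, rfl⟩, mem_limB_tup hG hq⟩
  · rintro ⟨_, ⟨r, hr, rfl⟩, hq⟩
    exact Part.mem_unique (mem_limB_tup hG hr) hq ▸ hr

/-- The value at the largest argument below `k` where `f` is defined, and `0` if there is none. -/
def lastValue (f : ℕ → Option ℕ) (k : ℕ) : ℕ :=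
  Nat.rec 0 (fun i y => (f i).getD y) k

theorem lastValue_eq {f : ℕ → Option ℕ} {y i₀ : ℕ} (hi₀ : f i₀ = some y)
    (hf : ∀ i z, i₀ ≤ i → f i = some z → z = y) {k : ℕ} (hk : i₀ < k) : lastValue f k = y := by
  induction k, hk using Nat.le_induction with
  | base => simp [lastValue, hi₀]
  | succ k hk ih =>
    change (f k).getD (lastValue f k) = y
    cases h : f k with
    | none => exact ih
    | some z => exact hf k z (Nat.le_of_succ_le hk) h

theorem computable₂_lastValue {η : List ℕ → ℕ → Option ℕ} (hη : Computable₂ η) :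
    Computable₂ fun u n => lastValue (fun i => η u (Nat.pair i n)) u.length := by
  refine Computable.nat_rec (f := fun a : List ℕ × ℕ => a.1.length) (g := fun _ => 0)
    (h := fun a b => (η a.1 (Nat.pair b.1 a.2)).getD b.2)
    (Computable.list_length.comp Computable.fst) (Computable.const 0) ?_
  have hcell : Primrec fun x : (List ℕ × ℕ) × ℕ × ℕ => Nat.pair x.2.1 x.1.2 :=
    Primrec₂.natPair.comp (Primrec.fst.comp Primrec.snd) (Primrec.snd.comp Primrec.fst)
  exact Computable.option_getD (hη.comp (Computable.fst.comp Computable.fst) hcell.to_comp)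
    (Computable.snd.comp Computable.snd)

/-- Every value produced by a one-way approximation on a point of the domain is correct. -/
theorem OneWayApprox.eq_of_eq_some {η : List ℕ → ℕ → Option ℕ} {F : Baire →. Baire}
    (hF : OneWayApprox η F) (hη : PrefixMono η) {p q : Baire} (hq : q ∈ F p) {k m y : ℕ}
    (hy : η (pre p k) m = some y) : y = q m := by
  obtain ⟨l, hl⟩ := hF p q hq m
  have h₁ := hη _ _ _ _ (pre_prefix p (le_max_left k l)) hy
  have h₂ := hη _ _ _ _ (pre_prefix p (le_max_right k l)) hl
  exact Option.some.inj (h₁.symm.trans h₂)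

theorem ComputableFn.limitComputableFn_limB_comp {F : Baire →. Baire} (hF : ComputableFn F) :
    LimitComputableFn (limB.comp F) := by
  obtain ⟨η, hη, hmono, happrox⟩ := hF
  refine ⟨_, computable₂_lastValue hη, ?_⟩
  intro p q hq n
  obtain ⟨r, hr, hq⟩ := mem_comp_iff.1 hq
  obtain ⟨i₀, hi₀⟩ := mem_limB_iff.1 hq n
  obtain ⟨l, hl⟩ := happrox p r hr (Nat.pair i₀ n)
  refine ⟨max (i₀ + 1) l, fun k hk => ?_⟩
  have hdef := hmono _ _ _ _ (pre_prefix p ((le_max_right _ _).trans hk)) hl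
  refine lastValue_eq (i₀ := i₀) (hdef.trans (congrArg some (hi₀ i₀ le_rfl))) ?_ ?_
  · intro i z hi hz
    exact (happrox.eq_of_eq_some hmono hr hz).trans (hi₀ i hi)
  · rw [length_pre]
    exact (le_max_left _ _).trans hk

/-- **Limit normal form theorem.** A partial function `G :⊆ ℕ^ℕ → ℕ^ℕ` is limit
computable if and only if there exists a computable partial function
`F :⊆ ℕ^ℕ → ℕ^ℕ` such that `G = lim ∘ F`. -/
theorem limit_normal_form (G : Baire →. Baire) :
    LimitComputableFn G ↔ ∃ F : Baire →. Baire, ComputableFn F ∧ G = limB.comp F := by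
  constructor
  · rintro ⟨η, hη, hG⟩
    exact ⟨stages η G, computableFn_stages hη G, eq_limB_comp_stages hG⟩
  · rintro ⟨F, hF, rfl⟩
    exact hF.limitComputableFn_limB_comp

end LimitComp
end

section
/- Jump inversion: The Turing jump operator J : ℕ^ℕ → ℕ^ℕ is injective, and its partial inverse J⁻¹ :⊆ ℕ^ℕ → ℕ^ℕ (defined on the range of J) is computable; in fact there is a computable F :⊆ ℕ^ℕ → ℕ^ℕ with F ∘ J = id on ℕ^ℕ. -/
open scoped Classical

namespace LimitComp

theorem pre_getElem? (p : Baire) (k n : ℕ) :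
    (pre p k)[n]? = if n < k then some (p n) else none := by
  simp [pre, List.getElem?_ofFn]

/-- There are primitive recursively computable indices of machines that halt on `p` exactly when
`p n = y`. -/
theorem exists_index_halts_iff_eq :
    ∃ c : ℕ → ℕ → ℕ, Primrec₂ c ∧ ∀ n y p, haltsOn (c n y) p ↔ p n = y := by
  let g : ℕ × ℕ → List ℕ → Option ℕ := fun a l => if l[a.1]? = some a.2 then some 0 else none
  have hg : Primrec₂ g := by
    refine Primrec.ite (Primrec.eq.comp ?_ ?_) (Primrec.const _) (Primrec.const _)
    · exact Primrec.list_getElem?.comp Primrec.snd (Primrec.fst.comp Primrec.fst)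
    · exact Primrec.option_some.comp (Primrec.snd.comp Primrec.fst)
  have hf : Partrec fun m : ℕ =>
      (g (m.unpair.1.unpair) (Denumerable.ofNat (List ℕ) m.unpair.2) : Part ℕ) := by
    refine Computable.ofOption (Primrec.to_comp ?_)
    refine hg.comp (Primrec.unpair.comp (Primrec.fst.comp Primrec.unpair)) ?_
    exact (Primrec.ofNat (List ℕ)).comp (Primrec.snd.comp Primrec.unpair)
  obtain ⟨e, he⟩ := Nat.Partrec.Code.exists_code.1 (Partrec.nat_iff.1 hf)
  refine ⟨fun n y => Encodable.encode (e.curry (Nat.pair n y)), ?_, fun n y p => ?_⟩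
  · exact Primrec.encode.comp
      (Nat.Partrec.Code.primrec₂_curry.comp (Primrec.const e) Primrec₂.natPair)
  · have key (k : ℕ) : ((e.curry (Nat.pair n y)).eval (Encodable.encode (pre p k))).Dom ↔
        n < k ∧ p n = y := by
      rw [Nat.Partrec.Code.eval_curry, he]
      simp only [Nat.unpair_pair, Denumerable.ofNat_encode, g, pre_getElem?]
      by_cases h : n < k <;> by_cases hpn : p n = y <;> simp [h, hpn]
    simp only [haltsOn, Denumerable.ofNat_encode, key]
    exact ⟨fun ⟨_, h⟩ => h.2, fun h => ⟨n + 1, n.lt_succ_self, h⟩⟩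

/-- Read off the value at `n` from a finite prefix `u` of a jump: the first `y` whose answer
`u[c n y]?` is not known to be negative, provided that answer is known to be positive. -/
def decodeJump (c : ℕ → ℕ → ℕ) (u : List ℕ) (n : ℕ) : Option ℕ :=
  let y := (List.range u.length).findIdx fun y => !decide (u[c n y]? = some 0)
  if u[c n y]? = some 1 then some y else none

theorem decodeJump_primrec {c : ℕ → ℕ → ℕ} (hc : Primrec₂ c) : Primrec₂ (decodeJump c) := by
  have hy : Primrec₂ fun (u : List ℕ) (n : ℕ) =>
      (List.range u.length).findIdx fun y => !decide (u[c n y]? = some 0) := by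
    refine Primrec.list_findIdx
      (Primrec.list_range.comp (Primrec.list_length.comp Primrec.fst)) ?_
    refine Primrec.not.comp (PrimrecPred.decide (Primrec.eq.comp ?_ (Primrec.const _)))
    exact Primrec.list_getElem?.comp (Primrec.fst.comp Primrec.fst)
      (hc.comp (Primrec.snd.comp Primrec.fst) Primrec.snd)
  refine Primrec.ite (Primrec.eq.comp ?_ (Primrec.const _)) (Primrec.option_some.comp hy)
    (Primrec.const _)
  exact Primrec.list_getElem?.comp Primrec.fst (hc.comp Primrec.snd hy)

theorem findIdx_range_eq {P : ℕ → Bool} {m y : ℕ} (hm : y ≤ m) (hy : y < m → P y = true)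
    (hlt : ∀ z < y, P z = false) : (List.range m).findIdx P = y := by
  rcases hm.lt_or_eq with h | rfl
  · rw [List.findIdx_eq (by simpa using h)]
    simpa using ⟨hy h, hlt⟩
  · simpa using List.findIdx_eq_length_of_false (xs := List.range y) (p := P) (by simpa using hlt)

theorem decodeJump_eq_some_iff {c : ℕ → ℕ → ℕ} {u : List ℕ} {n y : ℕ} :
    decodeJump c u n = some y ↔
      y ≤ u.length ∧ u[c n y]? = some 1 ∧ ∀ z < y, u[c n z]? = some 0 := by
  unfold decodeJump
  constructor
  · intro h
    simp only [Option.ite_none_right_eq_some, Option.some.injEq] at h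
    obtain ⟨h, rfl⟩ := h
    have hle := List.findIdx_le_length (xs := List.range u.length)
      (p := fun y => !decide (u[c n y]? = some 0))
    rw [List.length_range] at hle
    refine ⟨hle, h, fun z hz => ?_⟩
    simpa using List.not_of_lt_findIdx hz
  · rintro ⟨hle, h, hlt⟩
    rw [findIdx_range_eq hle (by simp [h]) (by simpa using hlt)]
    simp [h]

theorem decodeJump_prefixMono (c : ℕ → ℕ → ℕ) : PrefixMono (decodeJump c) := by
  intro u v n y huv h
  rw [decodeJump_eq_some_iff] at h ⊢
  have mono {i a : ℕ} (hi : u[i]? = some a) : v[i]? = some a := by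
    obtain ⟨w, rfl⟩ := huv
    rw [List.getElem?_append_left (List.getElem?_eq_some_iff.1 hi).1, hi]
  exact ⟨h.1.trans huv.length_le, mono h.2.1, fun z hz => mono (h.2.2 z hz)⟩

theorem exists_decodeJump_eq {c : ℕ → ℕ → ℕ} (hc : ∀ n y p, haltsOn (c n y) p ↔ p n = y)
    (p : Baire) (n : ℕ) : ∃ k, decodeJump c (pre (jump p) k) n = some (p n) := by
  obtain ⟨b, hb⟩ := ((Set.finite_Iic (p n)).image (c n)).bddAbove
  have hlt {z : ℕ} (hz : z ≤ p n) : c n z < max b (p n) + 1 :=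
    Nat.lt_succ_of_le ((hb ⟨z, hz, rfl⟩).trans (le_max_left _ _))
  refine ⟨max b (p n) + 1, decodeJump_eq_some_iff.2 ⟨?_, ?_, fun z hz => ?_⟩⟩
  · simpa [pre] using (le_max_right b (p n)).trans (Nat.le_succ _)
  · simp only [pre_getElem?, hlt le_rfl, if_true, jump, hc]
  · simp only [pre_getElem?, hlt hz.le, if_true, jump, hc, hz.ne', if_false]

theorem jump_injective : Function.Injective jump := by
  obtain ⟨c, -, hc⟩ := exists_index_halts_iff_eq
  intro p q h
  funext n
  have heq := congrFun h (c n (q n))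
  by_contra hne
  simp [jump, hc, hne] at heq

/-- **Jump inversion.** The Turing jump operator `J : ℕ^ℕ → ℕ^ℕ` is injective and
its partial inverse `J⁻¹ :⊆ ℕ^ℕ → ℕ^ℕ` is computable; in fact there is a
computable `F :⊆ ℕ^ℕ → ℕ^ℕ` with `F ∘ J = id` on `ℕ^ℕ`. -/
theorem jump_inversion :
    Function.Injective jump ∧
      ∃ F : Baire →. Baire, ComputableFn F ∧ ∀ p : Baire, F (jump p) = Part.some p := by
  refine ⟨jump_injective, fun r => ⟨∃ p, jump p = r, Classical.choose⟩, ?_, fun p => ?_⟩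
  · obtain ⟨c, hcp, hc⟩ := exists_index_halts_iff_eq
    refine ⟨decodeJump c, (decodeJump_primrec hcp).to_comp, decodeJump_prefixMono c, ?_⟩
    rintro _ q ⟨h, rfl⟩ n
    simpa only [Classical.choose_spec h] using exists_decodeJump_eq hc (Classical.choose h) n
  · rw [Part.eq_some_iff]
    exact ⟨⟨p, rfl⟩, jump_injective (Classical.choose_spec (⟨p, rfl⟩ : ∃ q, jump q = jump p))⟩

end LimitComp
end
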